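/- arXiv:1705.09986 — 6 statements merged into one kernel-verified Lean document; each statement's English description precedes it below -/
import Mathlib

section
/- Let d ≥ 1, I = Fin d, and let A^i_{j,k} (i,j,k ∈ I) be complex numbers invariant under all permutations of (i,j,k). Define B^i_{j,k} = A^i_{j,k} and C^i_{j,k} = A^i_{j,k}, and let D^i (i ∈ I) be arbitrary complex numbers. Then (A,B,C,D) is a quantum Airy structure in tensor form on ℂ^d, i.e. relations (R1), (R2), (R3), (R4) all hold. -/
open Finset

/-- A quantum Airy structure in tensor form on `ℂ^d`. -/
def IsQuantumAiry (d : ℕ) (A B C : Fin d → Fin d → Fin d → ℂ) (D : Fin d → ℂ) : Prop :=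
  (∀ i j k, A i j k = A j i k) ∧ (∀ i j k, A i j k = A i k j) ∧
  (∀ i j k, C i j k = C i k j) ∧
  -- (R1)
  (∀ i j k l, ∑ a, (B i j a * A a k l + B i k a * A j a l + B i l a * A j a k)
            = ∑ a, (B j i a * A a k l + B j k a * A i a l + B j l a * A i a k)) ∧
  -- (R2)
  (∀ i j k l, ∑ a, (B i j a * B a k l + B i k a * B j a l + C i l a * A j a k)
            = ∑ a, (B j i a * B a k l + B j k a * B i a l + C j l a * A i a k)) ∧
  -- (R3)
  (∀ i j k l, ∑ a, (B i j a * C a k l + C i k a * B j a l + C i l a * B j a k)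
            = ∑ a, (B j i a * C a k l + C j k a * B i a l + C j l a * B i a k)) ∧
  -- (R4)
  (∀ i j, (∑ a, B i j a * D a) + (∑ a, ∑ b, C i a b * A j a b)
        = (∑ a, B j i a * D a) + (∑ a, ∑ b, C j a b * A i a b))

/-- A fully symmetric tensor `A`, with `B = C = A` and arbitrary `D`, is a quantum
Airy structure (this is the structure coming from a Frobenius algebra in an orthonormal
basis, where `A^i_{j,k} = ψ(e_i e_j e_k)`). -/
theorem frobenius_gives_quantum_airy (d : ℕ) (hd : 1 ≤ d)
    (A : Fin d → Fin d → Fin d → ℂ) (D : Fin d → ℂ)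
    (hA1 : ∀ i j k, A i j k = A j i k) (hA2 : ∀ i j k, A i j k = A i k j) :
    IsQuantumAiry d A A A D := by
  have key : ∀ i j k l, ∑ a, (A i j a * A a k l + A i k a * A j a l + A i l a * A j a k)
      = ∑ a, (A j i a * A a k l + A j k a * A i a l + A j l a * A i a k) := by
    intro i j k l
    refine Finset.sum_congr rfl fun a _ => ?_
    rw [hA1 i j a, hA2 i k a, hA2 i l a, hA2 j k a, hA2 j l a]
    ring
  refine ⟨hA1, hA2, hA2, key, key, key, ?_⟩
  intro i j
  congr 1
  · exact Finset.sum_congr rfl fun a _ => by rw [hA1 i j a]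
  · exact Finset.sum_congr rfl fun a _ => Finset.sum_congr rfl fun b _ => mul_comm _ _
end

section
/- Let f : ℝ → ℝ be defined by f(z) = −2·log(1 + e^{−z/2}). For every integer k ≥ 0 and every real x, the integral H_k(x) = ∫₀^∞ ℓ^{2k+1} ( f(ℓ + x) − f(ℓ − x) ) dℓ converges and equals the odd polynomial of degree 2k+3 given by H_k(x) = (2k+1)! · Σ_{i=0}^{k+1} θ_{i−1} · x^{2k+3−2i} / (2k+3−2i)!, where θ_{−1} = 1 and θ_{i−1} = (2^{2i+1} − 4)·ζ(2i) for i ≥ 1, ζ being the Riemann zeta function. -/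
open MeasureTheory

noncomputable section

/-- Mirzakhani's function `f(z) = -2 log(1 + e^{-z/2})`. -/
def fMirz (z : ℝ) : ℝ := -2 * Real.log (1 + Real.exp (-z / 2))

/-- The integral `H_k(x) = ∫₀^∞ ℓ^{2k+1} (f(ℓ+x) - f(ℓ-x)) dℓ`. -/
def Hfun (k : ℕ) (x : ℝ) : ℝ :=
  ∫ ℓ in Set.Ioi (0 : ℝ), ℓ ^ (2 * k + 1) * (fMirz (ℓ + x) - fMirz (ℓ - x))

/-- The coefficients `θ_{i-1}`: `θ_{-1} = 1` and `θ_{i-1} = (2^{2i+1}-4) ζ(2i)` for `i ≥ 1`. -/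
def thetaCoef (i : ℕ) : ℂ :=
  if i = 0 then 1 else ((2 : ℂ) ^ (2 * i + 1) - 4) * riemannZeta (2 * (i : ℂ))
def LL (t : ℝ) : ℝ := Real.log (1 + Real.exp (-t / 2))

def PP (t : ℝ) : ℝ := -Real.log (1 - Real.exp (-t))

def Sz (n : ℕ) : ℝ := ∑' j : ℕ, 1 / ((j : ℝ) + 1) ^ (n + 2)

lemma LL_cont : Continuous LL := by
  unfold LL
  refine Continuous.log (by fun_prop) (fun t => ?_)
  positivity

lemma Sz_summable (n : ℕ) : Summable (fun j : ℕ => 1 / ((j : ℝ) + 1) ^ (n + 2)) := by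
  have h := (summable_nat_add_iff 1).2
    (Real.summable_one_div_nat_pow.2 (by omega : 1 < n + 2))
  simpa using h

lemma Sz_pos (n : ℕ) : 0 < Sz n := by
  refine (Sz_summable n).tsum_pos (fun j => by positivity) 0 (by positivity)

lemma Sz_zeta (n : ℕ) : ((Sz n : ℝ) : ℂ) = riemannZeta ((n : ℂ) + 2) := by
  have h := zeta_nat_eq_tsum_of_gt_one (by omega : 1 < n + 2)
  have h2 : Summable (fun j : ℕ => 1 / (j : ℝ) ^ (n + 2)) :=
    Real.summable_one_div_nat_pow.2 (by omega : 1 < n + 2)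
  have h3 : Sz n = ∑' j : ℕ, 1 / (j : ℝ) ^ (n + 2) := by
    rw [h2.tsum_eq_zero_add]
    simp [Sz]
  rw [h3, Complex.ofReal_tsum]
  push_cast at h
  rw [h]
  push_cast
  rfl

lemma term_int (n j : ℕ) :
    ∫ t in Set.Ioi (0 : ℝ), t ^ n * (Real.exp (-t) ^ (j + 1) / ((j : ℝ) + 1)) =
      n.factorial * (1 / ((j : ℝ) + 1) ^ (n + 2)) := by
  have h := Real.integral_rpow_mul_exp_neg_mul_Ioi (a := (n : ℝ) + 1) (r := (j : ℝ) + 1)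
    (by positivity) (by positivity)
  rw [Real.Gamma_nat_eq_factorial] at h
  have e : ∀ t : ℝ, t ^ n * (Real.exp (-t) ^ (j + 1) / ((j : ℝ) + 1)) =
      (t ^ ((n : ℝ) + 1 - 1) * Real.exp (-(((j : ℝ) + 1) * t))) * (1 / ((j : ℝ) + 1)) := by
    intro t
    rw [add_sub_cancel_right, Real.rpow_natCast, ← Real.exp_nat_mul]
    push_cast
    rw [show ((j : ℝ) + 1) * -t = -(((j : ℝ) + 1) * t) by ring]
    ring
  simp_rw [e]
  rw [integral_mul_const, h]
  rw [show (n : ℝ) + 1 = ((n + 1 : ℕ) : ℝ) by push_cast; ring, Real.rpow_natCast, one_div_pow]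
  field_simp
  ring

lemma term_integrable (n j : ℕ) :
    IntegrableOn (fun t : ℝ => t ^ n * (Real.exp (-t) ^ (j + 1) / ((j : ℝ) + 1)))
      (Set.Ioi (0 : ℝ)) := by
  apply Integrable.of_integral_ne_zero
  rw [term_int]
  positivity

lemma PP_int (n : ℕ) : ∫ t in Set.Ioi (0 : ℝ), t ^ n * PP t = n.factorial * Sz n := by
  have hs : Summable (fun j : ℕ => ∫ t in Set.Ioi (0 : ℝ),
      ‖t ^ n * (Real.exp (-t) ^ (j + 1) / ((j : ℝ) + 1))‖) := by
    have : (fun j : ℕ => ∫ t in Set.Ioi (0 : ℝ),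
      ‖t ^ n * (Real.exp (-t) ^ (j + 1) / ((j : ℝ) + 1))‖) =
      fun j : ℕ => n.factorial * (1 / ((j : ℝ) + 1) ^ (n + 2)) := by
      funext j
      rw [← term_int]
      refine setIntegral_congr_fun measurableSet_Ioi (fun t ht => ?_)
      have ht : 0 < t := ht
      exact Real.norm_of_nonneg (by positivity)
    rw [this]
    exact (Sz_summable n).mul_left _
  have h := hasSum_integral_of_summable_integral_norm (term_integrable n) hs
  simp_rw [term_int] at h
  have h2 := (Sz_summable n).hasSum.mul_left (n.factorial : ℝ)
  have h3 := h.unique h2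
  rw [Sz, ← h3]
  refine setIntegral_congr_fun measurableSet_Ioi (fun t ht => ?_)
  have ht : 0 < t := ht
  have hx : |Real.exp (-t)| < 1 := by
    rw [abs_of_pos (Real.exp_pos _)]
    exact (by rw [← Real.exp_zero]; exact Real.exp_lt_exp.2 (by linarith))
  have := (Real.hasSum_pow_div_log_of_abs_lt_one hx).mul_left (t ^ n)
  exact this.tsum_eq.symm

lemma PP_integrable (n : ℕ) : IntegrableOn (fun t : ℝ => t ^ n * PP t) (Set.Ioi 0) := by
  apply Integrable.of_integral_ne_zero
  rw [PP_int]
  have := Sz_pos n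
  positivity

lemma LL_eq {t : ℝ} (ht : 0 < t) (n : ℕ) :
    t ^ n * LL t = 2 ^ n * (((1 / 2) * t) ^ n * PP ((1 / 2) * t)) - t ^ n * PP t := by
  have h : LL t = PP ((1 / 2) * t) - PP t := by
    unfold LL PP
    have e : Real.exp (-t) = Real.exp (-t / 2) ^ 2 := by
      rw [← Real.exp_nat_mul]; congr 1; push_cast; ring
    have e2 : -(1 / 2 * t) = -t / 2 := by ring
    have h1 : Real.exp (-t / 2) < 1 := (by rw [← Real.exp_zero]; exact Real.exp_lt_exp.2 (by linarith))
    have h0 := Real.exp_pos (-t / 2)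
    rw [e, e2, show 1 - Real.exp (-t / 2) ^ 2 = (1 + Real.exp (-t / 2)) * (1 - Real.exp (-t / 2))
      by ring, Real.log_mul (by positivity) (by linarith)]
    ring
  rw [h, mul_pow, ← mul_assoc, ← mul_assoc, ← mul_pow]
  norm_num
  ring

lemma half_integrable (n : ℕ) :
    IntegrableOn (fun t : ℝ => ((1 / 2) * t) ^ n * PP ((1 / 2) * t)) (Set.Ioi 0) := by
  have := (integrableOn_Ioi_comp_mul_left_iff (fun t : ℝ => t ^ n * PP t) 0
    (by norm_num : (0 : ℝ) < 1 / 2)).2 (by simpa using PP_integrable n)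
  exact this

lemma LL_integrable (n : ℕ) : IntegrableOn (fun t : ℝ => t ^ n * LL t) (Set.Ioi 0) := by
  have h := ((half_integrable n).const_mul (2 ^ n)).sub (PP_integrable n)
  refine IntegrableOn.congr_fun h (fun t ht => ?_) measurableSet_Ioi
  exact (LL_eq ht n).symm

lemma LL_int (n : ℕ) : ∫ t in Set.Ioi (0 : ℝ), t ^ n * LL t =
    (2 ^ (n + 1) - 1) * n.factorial * Sz n := by
  rw [setIntegral_congr_fun measurableSet_Ioi (fun t ht => LL_eq ht n),
    integral_sub ((half_integrable n).const_mul (2 ^ n)) (PP_integrable n), integral_const_mul,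
    integral_comp_mul_left_Ioi (fun t : ℝ => t ^ n * PP t) 0 (by norm_num : (0 : ℝ) < 1 / 2),
    mul_zero, PP_int, smul_eq_mul]
  norm_num
  ring

lemma shift_expand (m : ℕ) (a t : ℝ) : (t + a) ^ m * LL t =
    ∑ j ∈ Finset.range (m + 1), (a ^ j * (m.choose j : ℝ)) * (t ^ (m - j) * LL t) := by
  rw [add_comm, add_pow, Finset.sum_mul]
  refine Finset.sum_congr rfl (fun j _ => by ring)

lemma shift_integrable0 (m : ℕ) (a : ℝ) :
    IntegrableOn (fun t : ℝ => (t + a) ^ m * LL t) (Set.Ioi 0) := by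
  simp_rw [shift_expand]
  exact integrable_finsetSum _ (fun j _ => (LL_integrable (m - j)).const_mul _)

lemma shift_int0 (m : ℕ) (a : ℝ) :
    ∫ t in Set.Ioi (0 : ℝ), (t + a) ^ m * LL t =
    ∑ j ∈ Finset.range (m + 1), (a ^ j * (m.choose j : ℝ)) *
      ((2 ^ (m - j + 1) - 1) * (m - j).factorial * Sz (m - j)) := by
  simp_rw [shift_expand]
  rw [integral_finsetSum _ (fun j _ => (LL_integrable (m - j)).const_mul _)]
  simp_rw [integral_const_mul, LL_int]

lemma shift_cont (m : ℕ) (a : ℝ) : Continuous (fun t : ℝ => (t + a) ^ m * LL t) := by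
  have := LL_cont
  fun_prop

lemma shift_integrable (m : ℕ) (a b : ℝ) :
    IntegrableOn (fun t : ℝ => (t + a) ^ m * LL t) (Set.Ioi b) := by
  have h1 : IntegrableOn (fun t : ℝ => (t + a) ^ m * LL t) (Set.Icc b 0) :=
    (shift_cont m a).continuousOn.integrableOn_Icc
  refine (h1.union (shift_integrable0 m a)).mono_set (fun t ht => ?_)
  have ht : b < t := ht
  by_cases h : t ≤ 0
  · exact Or.inl ⟨ht.le, h⟩
  · exact Or.inr (not_le.1 h)

lemma pre_eq (x : ℝ) : (fun l : ℝ => l + x) ⁻¹' (Set.Ioi x) = Set.Ioi 0 := by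
  ext t; simp

lemma F_integrable (m : ℕ) (x : ℝ) :
    IntegrableOn (fun l : ℝ => l ^ m * LL (l + x)) (Set.Ioi 0) := by
  have h := ((measurePreserving_add_right volume x).integrableOn_comp_preimage
    (measurableEmbedding_addRight x)).2 (shift_integrable m (-x) x)
  rw [pre_eq] at h
  simpa [Function.comp_def] using h

lemma F_int (m : ℕ) (x : ℝ) :
    ∫ l in Set.Ioi (0 : ℝ), l ^ m * LL (l + x) =
      (∫ t in Set.Ioi (0 : ℝ), (t + -x) ^ m * LL t) - ∫ t in (0 : ℝ)..x, (t + -x) ^ m * LL t := by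
  have h := (measurePreserving_add_right volume x).setIntegral_preimage_emb
    (measurableEmbedding_addRight x) (fun t => (t + -x) ^ m * LL t) (Set.Ioi x)
  rw [pre_eq] at h
  simp only [add_neg_cancel_right] at h
  rw [h, ← intervalIntegral.integral_interval_add_Ioi (shift_integrable m (-x) 0)
    (shift_integrable m (-x) x)]
  ring

lemma LL_neg (t : ℝ) : LL (-t) = LL t + t / 2 := by
  unfold LL
  have e : 1 + Real.exp (- -t / 2) = (1 + Real.exp (-t / 2)) * Real.exp (t / 2) := by
    rw [add_mul, ← Real.exp_add, show -t / 2 + t / 2 = 0 by ring, Real.exp_zero, neg_neg]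
    ring
  rw [e, Real.log_mul (by positivity) (by positivity), Real.log_exp]

lemma poly_int (m : ℕ) (x : ℝ) :
    ∫ t in (0 : ℝ)..x, (x - t) ^ m * t = x ^ (m + 2) / ((m + 1) * (m + 2)) := by
  have h := intervalIntegral.integral_comp_sub_left (a := 0) (b := x)
    (fun u : ℝ => u ^ m * (x - u)) x
  simp only [sub_sub_cancel, sub_self, sub_zero] at h
  rw [h]
  have e : ∀ u : ℝ, u ^ m * (x - u) = x * u ^ m - u ^ (m + 1) := fun u => by ring
  simp_rw [e]
  rw [intervalIntegral.integral_sub (Continuous.intervalIntegrable (by fun_prop) _ _)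
    (Continuous.intervalIntegrable (by fun_prop) _ _), intervalIntegral.integral_const_mul,
    integral_pow, integral_pow]
  push_cast
  simp
  field_simp
  ring

lemma inner_int (m : ℕ) (hm : Odd m) (x : ℝ) :
    (∫ t in (0 : ℝ)..-x, (t + x) ^ m * LL t) - ∫ t in (0 : ℝ)..x, (t + -x) ^ m * LL t =
      - (1 / 2) * (x ^ (m + 2) / ((m + 1) * (m + 2))) := by
  have h := intervalIntegral.integral_comp_neg (a := 0) (b := x)
    (fun t : ℝ => (t + x) ^ m * LL t)
  rw [neg_zero, intervalIntegral.integral_symm 0 (-x)] at h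
  have c : Continuous (fun t : ℝ => -((-t + x) ^ m * LL (-t))) :=
    ((shift_cont m x).comp continuous_neg).neg
  rw [← neg_eq_iff_eq_neg] at h
  rw [← h, ← intervalIntegral.integral_neg, ← intervalIntegral.integral_sub
    (c.intervalIntegrable _ _)
    ((shift_cont m (-x)).intervalIntegrable _ _), ← poly_int, ← intervalIntegral.integral_const_mul]
  refine intervalIntegral.integral_congr (fun t _ => ?_)
  rw [LL_neg, show t + -x = -(x - t) by ring, hm.neg_pow, show -t + x = x - t by ring]
  ring

lemma sum_pair (g : ℕ → ℝ) (n : ℕ) : ∑ j ∈ Finset.range (2 * n), g j =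
    ∑ p ∈ Finset.range n, (g (2 * p) + g (2 * p + 1)) := by
  induction n with
  | zero => simp
  | succ n ih =>
    rw [show 2 * (n + 1) = 2 * n + 1 + 1 by ring, Finset.sum_range_succ, Finset.sum_range_succ, ih,
      Finset.sum_range_succ]
    ring

lemma integrand_eq (m : ℕ) (x l : ℝ) : l ^ m * (fMirz (l + x) - fMirz (l - x)) =
    (-2) * (l ^ m * LL (l + x) - l ^ m * LL (l + -x)) := by
  unfold fMirz LL
  rw [← sub_eq_add_neg]
  ring

lemma H_real (k : ℕ) (x : ℝ) : Hfun k x =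
    x ^ (2 * k + 3) / ((2 * k + 2) * (2 * k + 3)) +
    ∑ i ∈ Finset.range (k + 1), 4 * (x ^ (2 * k + 1 - 2 * i) * ((2 * k + 1).choose (2 * i) : ℝ) *
      ((2 ^ (2 * i + 1) - 1) * (2 * i).factorial * Sz (2 * i))) := by
  unfold Hfun
  simp_rw [integrand_eq]
  rw [integral_const_mul, integral_sub (F_integrable _ _) (F_integrable _ _), F_int, F_int]
  have h1 := inner_int (2 * k + 1) ⟨k, rfl⟩ x
  have h2 : (∫ t in Set.Ioi (0 : ℝ), (t + x) ^ (2 * k + 1) * LL t) -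
      (∫ t in Set.Ioi (0 : ℝ), (t + -x) ^ (2 * k + 1) * LL t) =
      ∑ i ∈ Finset.range (k + 1), 2 * (x ^ (2 * k + 1 - 2 * i) *
        ((2 * k + 1).choose (2 * i) : ℝ) *
        ((2 ^ (2 * i + 1) - 1) * (2 * i).factorial * Sz (2 * i))) := by
    rw [shift_int0, shift_int0, ← Finset.sum_sub_distrib,
      show 2 * k + 1 + 1 = 2 * (k + 1) by ring, sum_pair, ← Finset.sum_range_reflect]
    refine Finset.sum_congr rfl (fun i hi => ?_)
    have hi : i ≤ k := by simpa [Nat.lt_succ_iff] using hi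
    obtain ⟨p, rfl⟩ := Nat.exists_eq_add_of_le hi
    rw [show i + p + 1 - 1 - i = p by omega, show 2 * (i + p) + 1 - 2 * i = 2 * p + 1 by omega,
      show 2 * (i + p) + 1 - (2 * p + 1) = 2 * i by omega,
      Even.neg_pow ⟨p, by ring⟩, Odd.neg_pow ⟨p, rfl⟩,
      Nat.choose_symm_of_eq_add (show 2 * (i + p) + 1 = 2 * i + (2 * p + 1) by ring)]
    ring
  rw [neg_neg]
  have h3 : ∑ i ∈ Finset.range (k + 1), 4 * (x ^ (2 * k + 1 - 2 * i) *
        ((2 * k + 1).choose (2 * i) : ℝ) *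
        ((2 ^ (2 * i + 1) - 1) * (2 * i).factorial * Sz (2 * i))) =
      2 * ∑ i ∈ Finset.range (k + 1), 2 * (x ^ (2 * k + 1 - 2 * i) *
        ((2 * k + 1).choose (2 * i) : ℝ) *
        ((2 ^ (2 * i + 1) - 1) * (2 * i).factorial * Sz (2 * i))) := by
    rw [Finset.mul_sum]
    exact Finset.sum_congr rfl (fun i _ => by ring)
  rw [h3, ← h2]
  have h4 : x ^ (2 * k + 3) / ((2 * (k : ℝ) + 2) * (2 * k + 3)) =
      x ^ (2 * k + 1 + 2) / ((((2 * k + 1 : ℕ) : ℝ) + 1) * (((2 * k + 1 : ℕ) : ℝ) + 2)) := by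
    push_cast
    congr 1
    ring
  rw [h4]
  linear_combination (-2) * h1

/-- For every `k ≥ 0` and real `x`, the integral `H_k(x)` converges and equals the odd
polynomial `(2k+1)! Σ_{i=0}^{k+1} θ_{i-1} x^{2k+3-2i} / (2k+3-2i)!`. -/
theorem Hk_integral_formula (k : ℕ) (x : ℝ) :
    IntegrableOn (fun ℓ : ℝ => ℓ ^ (2 * k + 1) * (fMirz (ℓ + x) - fMirz (ℓ - x)))
      (Set.Ioi 0) ∧
    (Hfun k x : ℂ) = ((2 * k + 1).factorial : ℂ) *
      ∑ i ∈ Finset.range (k + 2),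
        thetaCoef i * (x : ℂ) ^ (2 * k + 3 - 2 * i) / ((2 * k + 3 - 2 * i).factorial : ℂ) := by
  constructor
  · simp_rw [integrand_eq]
    exact ((F_integrable _ _).sub (F_integrable _ _)).const_mul _
  · rw [Finset.sum_range_succ', mul_add, Finset.mul_sum, H_real, Complex.ofReal_add]
    refine (add_comm _ _).trans (congrArg₂ (fun a b : ℂ => a + b) ?_ ?_)
    · rw [Complex.ofReal_sum]
      refine Finset.sum_congr rfl (fun i hi => ?_)
      have hi : i ≤ k := by simpa [Nat.lt_succ_iff] using hi
      have hc := Nat.choose_mul_factorial_mul_factorial (show 2 * i ≤ 2 * k + 1 by omega)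
      have hc' : ((2 * k + 1).choose (2 * i) : ℂ) * ((2 * i).factorial : ℂ) *
        ((2 * k + 1 - 2 * i).factorial : ℂ) = ((2 * k + 1).factorial : ℂ) := by
        exact_mod_cast hc
      have hf : ((2 * k + 1 - 2 * i).factorial : ℂ) ≠ 0 := by
        exact_mod_cast Nat.factorial_ne_zero _
      rw [show 2 * k + 3 - 2 * (i + 1) = 2 * k + 1 - 2 * i by omega, ← hc', thetaCoef,
        if_neg (by omega)]
      push_cast
      rw [Sz_zeta]
      push_cast
      rw [show 2 * ((i : ℂ) + 1) = 2 * i + 2 by ring]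
      field_simp
      ring
    · have hf : ((2 * k + 1).factorial : ℂ) ≠ 0 := by
        exact_mod_cast Nat.factorial_ne_zero _
      have h2 : (2 * (k : ℂ) + 2) ≠ 0 := by exact_mod_cast (by omega : 2 * k + 2 ≠ 0)
      have h3 : (2 * (k : ℂ) + 3) ≠ 0 := by exact_mod_cast (by omega : 2 * k + 3 ≠ 0)
      rw [mul_zero, Nat.sub_zero, thetaCoef, if_pos rfl, Nat.factorial_succ (2 * k + 2),
        Nat.factorial_succ (2 * k + 1)]
      push_cast
      rw [show 2 * (k : ℂ) + 2 + 1 = 2 * k + 3 by ring, show 2 * (k : ℂ) + 1 + 1 = 2 * k + 2 by ring]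
      field_simp

end
end

section
/- Let f : ℝ → ℝ be defined by f(z) = −2·log(1 + e^{−z/2}) and for each integer k ≥ 0 let H_k(x) = ∫₀^∞ ℓ^{2k+1}( f(ℓ+x) − f(ℓ−x) ) dℓ, with the convention H_{−1} ≡ 0. Then for every k ≥ 0 the function H_k is twice differentiable on ℝ and for every real x, H_k''(x) = 2k(2k+1)·H_{k−1}(x) + (x if k = 0, else 0). -/
noncomputable section

lemma fM_deriv (z : ℝ) : HasDerivAt fMirz (1 - 1 / (1 + Real.exp (-z / 2))) z := by
  have hp : 0 < Real.exp (-z / 2) := Real.exp_pos _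
  have h1 : HasDerivAt (fun z : ℝ => -z / 2) (-1 / 2) z := (hasDerivAt_id z).neg.div_const 2
  have h2 := ((h1.exp.const_add 1).log (by positivity)).const_mul (-2)
  refine h2.congr_deriv ?_
  field_simp
  ring

lemma fM_cont : Continuous fMirz :=
  continuous_iff_continuousAt.2 fun z => (fM_deriv z).continuousAt

lemma fM_bound (z : ℝ) : |fMirz z| ≤ 2 * Real.exp (-z / 2) := by
  have hp : 0 < Real.exp (-z / 2) := Real.exp_pos _
  have h0 : 0 ≤ Real.log (1 + Real.exp (-z / 2)) := Real.log_nonneg (by linarith)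
  have h1 := Real.log_le_sub_one_of_pos (show 0 < 1 + Real.exp (-z / 2) by positivity)
  unfold fMirz
  rw [abs_le]
  constructor <;> linarith

lemma fM'_bound (z : ℝ) : |1 - 1 / (1 + Real.exp (-z / 2))| ≤ 2 * Real.exp (-z / 2) := by
  have hp : 0 < Real.exp (-z / 2) := Real.exp_pos _
  have : 1 - 1 / (1 + Real.exp (-z / 2)) = Real.exp (-z / 2) / (1 + Real.exp (-z / 2)) := by
    field_simp
    ring
  rw [this, abs_of_nonneg (by positivity), div_le_iff₀ (by positivity)]
  nlinarith

lemma int_base (n : ℕ) (c : ℝ) : MeasureTheory.IntegrableOn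
    (fun l : ℝ => l ^ n * (2 * Real.exp (-(l + c) / 2))) (Set.Ioi 0) := by
  have h := integrableOn_rpow_mul_exp_neg_mul_rpow (p := 1) (s := n) (b := 1 / 2)
    (by have : (0 : ℝ) ≤ n := n.cast_nonneg
        linarith) one_pos (by norm_num)
  have h2 := MeasureTheory.Integrable.const_mul h (2 * Real.exp (-c / 2))
  refine h2.congr (Filter.Eventually.of_forall fun l => ?_)
  simp only [Real.rpow_natCast, Real.rpow_one]
  rw [show -(l + c) / 2 = -c / 2 + -(1 / 2) * l by ring, Real.exp_add]
  ring

lemma int_gen (g : ℝ → ℝ) (hg : Continuous g) (hb : ∀ z, |g z| ≤ 2 * Real.exp (-z / 2))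
    (n : ℕ) (c : ℝ) : MeasureTheory.IntegrableOn (fun l : ℝ => l ^ n * g (l + c)) (Set.Ioi 0) := by
  refine MeasureTheory.Integrable.mono' (int_base n c)
    (by fun_prop : Continuous fun l : ℝ => l ^ n * g (l + c)).aestronglyMeasurable ?_
  refine (MeasureTheory.ae_restrict_mem measurableSet_Ioi).mono fun l hl => ?_
  have hl : 0 < l := hl
  rw [Real.norm_eq_abs, abs_mul, abs_of_pos (by positivity : 0 < l ^ n)]
  exact mul_le_mul_of_nonneg_left (hb _) (by positivity)

lemma fM'_cont : Continuous (fun z : ℝ => 1 - 1 / (1 + Real.exp (-z / 2))) := by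
  refine continuous_const.sub (continuous_const.div (by fun_prop) fun z => ?_)
  positivity

def AM (n : ℕ) (x : ℝ) : ℝ := ∫ l in Set.Ioi (0 : ℝ), l ^ n * fMirz (l + x)

lemma AM_ibp (n : ℕ) (x : ℝ) :
    ∫ l in Set.Ioi (0 : ℝ), l ^ n * (1 - 1 / (1 + Real.exp (-(l + x) / 2)))
      = -(n * AM (n - 1) x) - 0 ^ n * fMirz x := by
  have hi1 := (int_gen fMirz fM_cont fM_bound (n - 1) x).const_mul (n : ℝ)
  have hi2 := int_gen _ fM'_cont fM'_bound n x
  have hd : ∀ l ∈ Set.Ici (0 : ℝ), HasDerivAt (fun l : ℝ => l ^ n * fMirz (l + x))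
      (n * (l ^ (n - 1) * fMirz (l + x)) + l ^ n * (1 - 1 / (1 + Real.exp (-(l + x) / 2)))) l := by
    intro l _
    have := (hasDerivAt_pow n l).mul ((fM_deriv (l + x)).comp_add_const l x)
    refine this.congr_deriv ?_
    ring
  have ht : Filter.Tendsto (fun l : ℝ => l ^ n * fMirz (l + x)) Filter.atTop (nhds 0) := by
    have h := (tendsto_rpow_mul_exp_neg_mul_atTop_nhds_zero n (1 / 2) (by norm_num)).const_mul
      (2 * Real.exp (-x / 2))
    rw [mul_zero] at h
    refine squeeze_zero_norm' ?_ h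
    filter_upwards [Filter.eventually_gt_atTop 0] with l hl
    rw [Real.norm_eq_abs, abs_mul, abs_of_pos (by positivity : 0 < l ^ n), Real.rpow_natCast]
    refine (mul_le_mul_of_nonneg_left (fM_bound _) (by positivity)).trans_eq ?_
    rw [show -(l + x) / 2 = -x / 2 + -(1 / 2) * l by ring, Real.exp_add]
    ring
  have h := MeasureTheory.integral_Ioi_of_hasDerivAt_of_tendsto' hd (hi1.add hi2) ht
  rw [MeasureTheory.integral_add hi1 hi2, MeasureTheory.integral_const_mul, zero_add] at h
  unfold AM
  linarith

lemma AM_deriv (n : ℕ) (x : ℝ) :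
    HasDerivAt (AM n) (-(n * AM (n - 1) x) - 0 ^ n * fMirz x) x := by
  rw [← AM_ibp]
  refine (hasDerivAt_integral_of_dominated_loc_of_deriv_le
    (μ := MeasureTheory.volume.restrict (Set.Ioi (0 : ℝ)))
    (F := fun x l => l ^ n * fMirz (l + x))
    (F' := fun x l => l ^ n * (1 - 1 / (1 + Real.exp (-(l + x) / 2))))
    (bound := fun l => l ^ n * (2 * Real.exp (-(l + (x - 1)) / 2)))
    (Metric.ball_mem_nhds x one_pos) ?_ (int_gen _ fM_cont fM_bound n x)
    (int_gen _ fM'_cont fM'_bound n x).aestronglyMeasurable ?_ (int_base n (x - 1)) ?_).2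
  · exact Filter.Eventually.of_forall fun y =>
      (int_gen _ fM_cont fM_bound n y).aestronglyMeasurable
  · refine (MeasureTheory.ae_restrict_mem measurableSet_Ioi).mono fun l hl y hy => ?_
    have hl : 0 < l := hl
    rw [Real.norm_eq_abs, abs_mul, abs_of_pos (by positivity : 0 < l ^ n)]
    refine mul_le_mul_of_nonneg_left ((fM'_bound _).trans ?_) (by positivity)
    rw [Metric.mem_ball, Real.dist_eq, abs_lt] at hy
    have : Real.exp (-(l + y) / 2) ≤ Real.exp (-(l + (x - 1)) / 2) :=
      Real.exp_le_exp.2 (by linarith [hy.1])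
    linarith
  · refine Filter.Eventually.of_forall fun l y _ => ?_
    exact ((fM_deriv (l + y)).comp_const_add l y).const_mul _

lemma Hfun_eq (k : ℕ) : Hfun k = fun x => AM (2 * k + 1) x - AM (2 * k + 1) (-x) := by
  funext x
  unfold Hfun AM
  rw [← MeasureTheory.integral_sub (int_gen _ fM_cont fM_bound _ x)
    (int_gen _ fM_cont fM_bound _ (-x))]
  simp only [mul_sub, ← sub_eq_add_neg]

lemma fM_odd (x : ℝ) : fMirz x - fMirz (-x) = x := by
  unfold fMirz
  have h : 1 + Real.exp (-x / 2) = Real.exp (-x / 2) * (1 + Real.exp (- -x / 2)) := by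
    rw [mul_add, ← Real.exp_add, show -x / 2 + - -x / 2 = 0 by ring, Real.exp_zero]
    ring
  rw [h, Real.log_mul (by positivity) (by positivity), Real.log_exp]
  ring

lemma H_d1 (k : ℕ) (x : ℝ) : HasDerivAt (Hfun k)
    (-((2 * k + 1 : ℕ) : ℝ) * (AM (2 * k) x + AM (2 * k) (-x))) x := by
  rw [Hfun_eq]
  have h1 := AM_deriv (2 * k + 1) x
  have h2 := (AM_deriv (2 * k + 1) (-x)).comp x (hasDerivAt_neg x)
  refine (h1.sub h2).congr_deriv ?_
  simp only [Nat.add_sub_cancel, pow_succ]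
  ring

lemma H_d2 (k : ℕ) (x : ℝ) : HasDerivAt (deriv (Hfun k))
    (2 * k * (2 * k + 1) * (if k = 0 then 0 else Hfun (k - 1) x)
        + (if k = 0 then x else 0)) x := by
  rw [show deriv (Hfun k) = _ from funext fun x => (H_d1 k x).deriv]
  have h1 := AM_deriv (2 * k) x
  have h2 := (AM_deriv (2 * k) (-x)).comp x (hasDerivAt_neg x)
  refine ((h1.add h2).const_mul _).congr_deriv ?_
  rcases k with _ | k
  · have := fM_odd x
    simp
    linarith
  · rw [Hfun_eq]
    simp [show 2 * (k + 1) - 1 = 2 * k + 1 by omega]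
    ring

/-- Each `H_k` is twice differentiable and satisfies
`H_k''(x) = 2k(2k+1) H_{k-1}(x) + δ_{k,0} x`, with the convention `H_{-1} = 0`. -/
theorem Hk_second_derivative (k : ℕ) :
    (∀ x : ℝ, DifferentiableAt ℝ (Hfun k) x) ∧
    (∀ x : ℝ, DifferentiableAt ℝ (deriv (Hfun k)) x) ∧
    (∀ x : ℝ, deriv (deriv (Hfun k)) x =
      2 * k * (2 * k + 1) * (if k = 0 then 0 else Hfun (k - 1) x)
        + (if k = 0 then x else 0)) := by
  exact ⟨fun x => (H_d1 k x).differentiableAt, fun x => (H_d2 k x).differentiableAt,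
    fun x => (H_d2 k x).deriv⟩

end
end

section
/- Define f : ℝ → ℝ by f(z) = −2·log(1 + e^{−z/2}), and define d : ℝ³ → ℝ by d(ℓ₁,ℓ₂,ℓ₃) = log( ( cosh(ℓ₂/2) + cosh((ℓ₁+ℓ₃)/2) ) / ( cosh(ℓ₂/2) + cosh((ℓ₁−ℓ₃)/2) ) ). Then for all real ℓ₁, ℓ₂, ℓ₃: ℓ₁ − d(ℓ₁,ℓ₂,ℓ₃) = (1/2)·( f(ℓ₃+ℓ₂+ℓ₁) − f(ℓ₃+ℓ₂−ℓ₁) + f(ℓ₃−ℓ₂+ℓ₁) − f(ℓ₃−ℓ₂−ℓ₁) ). -/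
noncomputable section

/-- The hyperbolic distance function
`d(ℓ₁,ℓ₂,ℓ₃) = log( (cosh(ℓ₂/2) + cosh((ℓ₁+ℓ₃)/2)) / (cosh(ℓ₂/2) + cosh((ℓ₁-ℓ₃)/2)) )`. -/
def dMirz (l1 l2 l3 : ℝ) : ℝ :=
  Real.log ((Real.cosh (l2 / 2) + Real.cosh ((l1 + l3) / 2))
    / (Real.cosh (l2 / 2) + Real.cosh ((l1 - l3) / 2)))

theorem mirz_aux (s t : ℝ) :
    Real.log (1 + Real.exp (-(s + t) / 2)) + Real.log (1 + Real.exp (-(s - t) / 2))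
      = Real.log 2 - s / 2 + Real.log (Real.cosh (t / 2) + Real.cosh (s / 2)) := by
  have hc : Real.cosh (t / 2) + Real.cosh (s / 2) ≠ 0 := by
    have := Real.cosh_pos (t / 2)
    have := Real.cosh_pos (s / 2)
    positivity
  have h1 : Real.log 2 - s / 2 = Real.log (2 * Real.exp (-(s / 2))) := by
    rw [Real.log_mul (by norm_num) (Real.exp_ne_zero _), Real.log_exp]; ring
  rw [h1, ← Real.log_mul (by positivity) (by positivity), ← Real.log_mul (by positivity) hc]
  congr 1
  rw [Real.cosh_eq, Real.cosh_eq]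
  have e1 : Real.exp (-(s + t) / 2) = Real.exp (-(s / 2)) * Real.exp (-(t / 2)) := by
    rw [← Real.exp_add]; congr 1; ring
  have e2 : Real.exp (-(s - t) / 2) = Real.exp (-(s / 2)) * Real.exp (t / 2) := by
    rw [← Real.exp_add]; congr 1; ring
  have e3 : Real.exp (-(s / 2)) * Real.exp (s / 2) = 1 := by
    rw [← Real.exp_add]; simp
  have e4 : Real.exp (-(t / 2)) * Real.exp (t / 2) = 1 := by
    rw [← Real.exp_add]; simp
  rw [e1, e2]
  linear_combination (Real.exp (-(s / 2))) ^ 2 * e4 - e3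

/-- The kernel identity
`ℓ₁ - d(ℓ₁,ℓ₂,ℓ₃) = (1/2)(f(ℓ₃+ℓ₂+ℓ₁) - f(ℓ₃+ℓ₂-ℓ₁) + f(ℓ₃-ℓ₂+ℓ₁) - f(ℓ₃-ℓ₂-ℓ₁))`. -/
theorem mcshane_kernel_B (l1 l2 l3 : ℝ) :
    l1 - dMirz l1 l2 l3 =
      (1 / 2) * (fMirz (l3 + l2 + l1) - fMirz (l3 + l2 - l1)
        + fMirz (l3 - l2 + l1) - fMirz (l3 - l2 - l1)) := by
  have hc (x y : ℝ) : Real.cosh x + Real.cosh y ≠ 0 := by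
    have := Real.cosh_pos x
    have := Real.cosh_pos y
    positivity
  have a := mirz_aux (l3 + l1) l2
  have b := mirz_aux (l3 - l1) l2
  have c : Real.cosh ((l1 - l3) / 2) = Real.cosh ((l3 - l1) / 2) := by
    rw [← Real.cosh_neg]; congr 1; ring
  unfold dMirz fMirz
  rw [Real.log_div (hc _ _) (hc _ _), c, add_comm l1 l3,
    show l3 + l2 + l1 = l3 + l1 + l2 by ring, show l3 + l2 - l1 = l3 - l1 + l2 by ring,
    show l3 - l2 + l1 = l3 + l1 - l2 by ring, show l3 - l2 - l1 = l3 - l1 - l2 by ring]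
  linarith

end
end

section
/- Define f : ℝ → ℝ by f(z) = −2·log(1 + e^{−z/2}), and define d : ℝ³ → ℝ by d(ℓ₁,ℓ₂,ℓ₃) = log( ( cosh(ℓ₂/2) + cosh((ℓ₁+ℓ₃)/2) ) / ( cosh(ℓ₂/2) + cosh((ℓ₁−ℓ₃)/2) ) ). Then for all real ℓ₁, ℓ₂, ℓ₃: ℓ₁ − d(ℓ₁,ℓ₂,ℓ₃) − d(ℓ₁,ℓ₃,ℓ₂) = f(ℓ₃+ℓ₂+ℓ₁) − f(ℓ₃+ℓ₂−ℓ₁). -/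
noncomputable section

theorem aux_log (a b : ℝ) : Real.log (Real.cosh (b / 2) + Real.cosh (a / 2)) =
    Real.log (1 + Real.exp (-(a + b) / 2)) + (a + b) / 4
      + (Real.log (1 + Real.exp (-(a - b) / 2)) + (a - b) / 4) - Real.log 2 := by
  have h : Real.cosh (b / 2) + Real.cosh (a / 2) =
      (1 + Real.exp (-(a + b) / 2)) * Real.exp ((a + b) / 4)
        * ((1 + Real.exp (-(a - b) / 2)) * Real.exp ((a - b) / 4)) / 2 := by
    have e1 : Real.exp ((a + b) / 4) * Real.exp ((a - b) / 4) = Real.exp (a / 2) := by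
      rw [← Real.exp_add]; congr 1; ring
    have e2 : Real.exp (-(a + b) / 2) * Real.exp (a / 2) = Real.exp (-(b / 2)) := by
      rw [← Real.exp_add]; congr 1; ring
    have e3 : Real.exp (-(a - b) / 2) * Real.exp (a / 2) = Real.exp (b / 2) := by
      rw [← Real.exp_add]; congr 1; ring
    have e4 : Real.exp (-(a + b) / 2) * Real.exp (b / 2) = Real.exp (-(a / 2)) := by
      rw [← Real.exp_add]; congr 1; ring
    rw [Real.cosh_eq, Real.cosh_eq, ← e4, ← e2, ← e3, ← e1]
    ring
  have p (z : ℝ) : 1 + Real.exp z ≠ 0 := by positivity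
  have q (z : ℝ) : Real.exp z ≠ 0 := Real.exp_ne_zero z
  rw [h, Real.log_div (by positivity) (by norm_num), Real.log_mul (by positivity) (by positivity),
    Real.log_mul (p _) (q _), Real.log_mul (p _) (q _), Real.log_exp, Real.log_exp]

theorem aux_even (z : ℝ) : Real.log (1 + Real.exp (-z / 2)) + z / 2 =
    Real.log (1 + Real.exp (z / 2)) := by
  have h : 1 + Real.exp (z / 2) = (1 + Real.exp (-z / 2)) * Real.exp (z / 2) := by
    rw [add_mul, ← Real.exp_add, show -z / 2 + z / 2 = 0 by ring, Real.exp_zero]; ring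
  rw [h, Real.log_mul (by positivity) (by positivity), Real.log_exp]

/-- The kernel identity
`ℓ₁ - d(ℓ₁,ℓ₂,ℓ₃) - d(ℓ₁,ℓ₃,ℓ₂) = f(ℓ₃+ℓ₂+ℓ₁) - f(ℓ₃+ℓ₂-ℓ₁)`. -/
theorem mcshane_kernel_C (l1 l2 l3 : ℝ) :
    l1 - dMirz l1 l2 l3 - dMirz l1 l3 l2 =
      fMirz (l3 + l2 + l1) - fMirz (l3 + l2 - l1) := by
  have c (x y : ℝ) : Real.cosh x + Real.cosh y ≠ 0 :=
    (add_pos (Real.cosh_pos x) (Real.cosh_pos y)).ne'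
  unfold dMirz fMirz
  rw [Real.log_div (c _ _) (c _ _), Real.log_div (c _ _) (c _ _)]
  simp only [aux_log]
  have k := aux_even (l3 + l2 - l1)
  have r1 : -(l1 + l3 + l2) / 2 = -(l3 + l2 + l1) / 2 := by ring
  have r2 : -(l1 + l2 + l3) / 2 = -(l3 + l2 + l1) / 2 := by ring
  have r3 : -(l1 - l3 - l2) / 2 = (l3 + l2 - l1) / 2 := by ring
  have r4 : -(l1 - l2 - l3) / 2 = (l3 + l2 - l1) / 2 := by ring
  have r5 : -(l1 - l3 + l2) / 2 = -(l1 + l2 - l3) / 2 := by ring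
  have r6 : -(l1 - l2 + l3) / 2 = -(l1 + l3 - l2) / 2 := by ring
  rw [r1, r2, r3, r4, r5, r6, ← k]
  ring

end
end

section
/- Let ℏ > 0 be a real number and let g : ℝ → ℝ be twice differentiable with g''(y) = y·g(y) for all y ∈ ℝ. Define Z : ℝ → ℝ by Z(x) = exp( (x − x²/2)/ℏ ) · g( (1 − 2x − ℏ) / (2ℏ)^{2/3} ). Then Z is twice differentiable and for every x ∈ ℝ, ℏ·Z'(x) − (1/2)x²·Z(x) − ℏ·x·Z'(x) − (ℏ²/2)·Z''(x) − ℏ·Z(x) = 0. -/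
noncomputable section

/-- The wave function `Z(x) = exp((x - x²/2)/ℏ) · g((1 - 2x - ℏ)/(2ℏ)^{2/3})`. -/
def Zfun (ℏ : ℝ) (g : ℝ → ℝ) (x : ℝ) : ℝ :=
  Real.exp ((x - x ^ 2 / 2) / ℏ) * g ((1 - 2 * x - ℏ) / (2 * ℏ) ^ ((2 : ℝ) / 3))

/-- If `g` solves the Airy equation `g'' = y g`, then `Z(x) = exp((x-x²/2)/ℏ) g(y(x))` with
`y = (1-2x-ℏ)/(2ℏ)^{2/3}` is twice differentiable and annihilated by the operator
`L = ℏ∂_x - (1/2)x² - ℏx∂_x - (ℏ²/2)∂_x² - ℏ`. -/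
theorem airy_wave_function (ℏ : ℝ) (hℏ : 0 < ℏ) (g : ℝ → ℝ)
    (hg : ∀ y : ℝ, DifferentiableAt ℝ g y)
    (hg' : ∀ y : ℝ, DifferentiableAt ℝ (deriv g) y)
    (hairy : ∀ y : ℝ, deriv (deriv g) y = y * g y) :
    (∀ x : ℝ, DifferentiableAt ℝ (Zfun ℏ g) x) ∧
    (∀ x : ℝ, DifferentiableAt ℝ (deriv (Zfun ℏ g)) x) ∧
    (∀ x : ℝ,
      ℏ * deriv (Zfun ℏ g) x - (1 / 2) * x ^ 2 * Zfun ℏ g x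
        - ℏ * x * deriv (Zfun ℏ g) x - (ℏ ^ 2 / 2) * deriv (deriv (Zfun ℏ g)) x
        - ℏ * Zfun ℏ g x = 0) := by
  have hE : ∀ x : ℝ, HasDerivAt (fun x : ℝ => Real.exp ((x - x ^ 2 / 2) / ℏ))
      (Real.exp ((x - x ^ 2 / 2) / ℏ) * ((1 - x) / ℏ)) x := by
    intro x
    have h := (((hasDerivAt_id x).sub (((hasDerivAt_id x).pow 2).div_const 2)).div_const ℏ).exp
    convert h using 1
    all_goals try simp
  have hc : 0 < (2 * ℏ) ^ ((2 : ℝ) / 3) := Real.rpow_pos_of_pos (by linarith) _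
  have hc3 : ((2 * ℏ) ^ ((2 : ℝ) / 3)) ^ 3 = 4 * ℏ ^ 2 := by
    rw [← Real.rpow_natCast, ← Real.rpow_mul (by linarith)]
    norm_num
    ring
  have hZ0 : Zfun ℏ g = fun x => Real.exp ((x - x ^ 2 / 2) / ℏ) *
      g ((1 - 2 * x - ℏ) / (2 * ℏ) ^ ((2 : ℝ) / 3)) := rfl
  rw [hZ0]
  generalize (2 * ℏ) ^ ((2 : ℝ) / 3) = c at hc hc3
  have hy : ∀ x : ℝ, HasDerivAt (fun x : ℝ => (1 - 2 * x - ℏ) / c) (-2 / c) x := by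
    intro x
    have h := ((((hasDerivAt_id x).const_mul 2).const_sub 1).sub_const ℏ).div_const c
    have e : -2 / c = -(2 * 1) / c := by norm_num
    rw [e]
    exact h
  have hG : ∀ x : ℝ, HasDerivAt (fun x : ℝ => g ((1 - 2 * x - ℏ) / c))
      (deriv g ((1 - 2 * x - ℏ) / c) * (-2 / c)) x := fun x =>
    HasDerivAt.comp x (hg _).hasDerivAt (hy x)
  have hG' : ∀ x : ℝ, HasDerivAt (fun x : ℝ => deriv g ((1 - 2 * x - ℏ) / c))
      (((1 - 2 * x - ℏ) / c * g ((1 - 2 * x - ℏ) / c)) * (-2 / c)) x := fun x => by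
    rw [← hairy]
    exact HasDerivAt.comp x (hg' _).hasDerivAt (hy x)
  have hl : ∀ x : ℝ, HasDerivAt (fun x : ℝ => (1 - x) / ℏ) (-1 / ℏ) x := fun x =>
    ((hasDerivAt_id x).const_sub 1).div_const ℏ
  have hZ := fun x => (hE x).mul (hG x)
  have hdZ := funext fun x => (hZ x).deriv
  have hZ2 := fun x => (((hE x).mul (hl x)).mul (hG x)).add ((hE x).mul ((hG' x).mul_const (-2 / c)))
  have hdZ' : deriv (fun x => Real.exp ((x - x ^ 2 / 2) / ℏ) * g ((1 - 2 * x - ℏ) / c)) =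
    fun x => Real.exp ((x - x ^ 2 / 2) / ℏ) * ((1 - x) / ℏ) * g ((1 - 2 * x - ℏ) / c) +
      Real.exp ((x - x ^ 2 / 2) / ℏ) * (deriv g ((1 - 2 * x - ℏ) / c) * (-2 / c)) := hdZ
  rw [hdZ']
  refine ⟨fun x => (hZ x).differentiableAt, fun x => (hZ2 x).differentiableAt, fun x => ?_⟩
  have h2 := (hZ2 x).deriv
  erw [h2]
  simp only [Pi.mul_apply]
  generalize g ((1 - 2 * x - ℏ) / c) = G
  generalize deriv g ((1 - 2 * x - ℏ) / c) = H
  generalize Real.exp ((x - x ^ 2 / 2) / ℏ) = E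
  have key : ((1 - 2 * x - ℏ) / c * G) * (-2 / c) * (-2 / c) = (1 - 2 * x - ℏ) * G / ℏ ^ 2 := by
    have h : ((1 - 2 * x - ℏ) / c * G) * (-2 / c) * (-2 / c) = 4 * (1 - 2 * x - ℏ) * G / c ^ 3 := by
      field_simp
      try ring
    rw [h, hc3]
    field_simp
  rw [key]
  field_simp
  ring

end
end
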